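/- For every n ≥ 1, the following identity holds in F, where every complete homogeneous symmetric polynomial h_m below is evaluated at the 2n quantities (u X_1, …, u X_n, v X_1^{−1}, …, v X_n^{−1}): [ det_{1 ≤ i, j ≤ n}( (u²X_i² + u w X_i)^{j−1} + (v²X_i^{−2} + v w X_i^{−1})^{j−1} ) · det_{1 ≤ i, j ≤ n}( (u²X_i² + u w X_i)^j − (v²X_i^{−2} + v w X_i^{−1})^j ) ] / [ ∏_{1 ≤ i < j ≤ n} (X_j − X_i)(u^{−1} v X_j^{−1} − u^{−1} v X_i^{−1}) · ∏_{i=1}^{n} ∏_{j=1}^{n} (u^{−1} v X_j^{−1} − X_i) ] = (−1)^n · u^{n² + binom(n,2)} · v^{−binom(n,2)} · det_{1 ≤ i, j ≤ n−1}( Σ_{k=j}^{2j} binom(j, k−j) w^{2j−k} ( h_{k−i} − u^{n−i} v^{n−i} h_{k+i−2n} ) ) · det_{1 ≤ i, j ≤ n}( Σ_{k=j}^{2j} binom(j, k−j) w^{2j−k} ( h_{k+i−n−1} + u^{i−1} v^{i−1} h_{k−i−n+1} ) ), where for n = 1 the empty (n−1) × (n−1) determinant is set equal to 1. -/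

import Mathlib

noncomputable section

/-- Complete homogeneous symmetric polynomial of degree `m` evaluated at the list `l`. -/
def hpow {R : Type*} [CommSemiring R] : ℕ → List R → R
  | 0, _ => 1
  | _ + 1, [] => 0
  | m + 1, x :: xs => hpow (m + 1) xs + x * hpow m (x :: xs)
  termination_by m l => m + l.length

/-- `h_m` with integer degree: zero for negative degrees. -/
def hz {R : Type*} [CommSemiring R] (m : ℤ) (l : List R) : R :=
  if m < 0 then 0 else hpow m.toNat l

/-- Elementary symmetric polynomial of degree `m` evaluated at the list `l`;
zero for `m` larger than the length of `l`. -/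
def epow {R : Type*} [CommSemiring R] : ℕ → List R → R
  | 0, _ => 1
  | _ + 1, [] => 0
  | m + 1, x :: xs => epow (m + 1) xs + x * epow m xs

/-- `e_m` with integer degree: zero for negative degrees. -/
def ez {R : Type*} [CommSemiring R] (m : ℤ) (l : List R) : R :=
  if m < 0 then 0 else epow m.toNat l

/-- The field `F = ℚ(u, v, w, X_1, …, X_n)` of rational functions. -/
abbrev Fld (n : ℕ) : Type := FractionRing (MvPolynomial (Fin n ⊕ Fin 3) ℚ)

/-- The indeterminate `u`. -/
def uu (n : ℕ) : Fld n :=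
  algebraMap (MvPolynomial (Fin n ⊕ Fin 3) ℚ) (Fld n) (MvPolynomial.X (Sum.inr 0))

/-- The indeterminate `v`. -/
def vv (n : ℕ) : Fld n :=
  algebraMap (MvPolynomial (Fin n ⊕ Fin 3) ℚ) (Fld n) (MvPolynomial.X (Sum.inr 1))

/-- The indeterminate `w`. -/
def wP (n : ℕ) : Fld n :=
  algebraMap (MvPolynomial (Fin n ⊕ Fin 3) ℚ) (Fld n) (MvPolynomial.X (Sum.inr 2))

/-- The indeterminate `X_i` (here `i : Fin n` corresponds to `X_{i+1}`). -/
def XP {n : ℕ} (i : Fin n) : Fld n :=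
  algebraMap (MvPolynomial (Fin n ⊕ Fin 3) ℚ) (Fld n) (MvPolynomial.X (Sum.inl i))

/-- The `2n` quantities `(u X_1, …, u X_n, v X_1^{−1}, …, v X_n^{−1})`. -/
def bigArgs (n : ℕ) : List (Fld n) :=
  ((List.finRange n).map fun i => uu n * XP i) ++ ((List.finRange n).map fun i => vv n * (XP i)⁻¹)

/-- `h_m(u X_1, …, u X_n, v X_1^{−1}, …, v X_n^{−1})`. -/
def Hn (n : ℕ) (m : ℤ) : Fld n := hz m (bigArgs n)

theorem hpow_cons_succ {R : Type*} [CommSemiring R] (m : ℕ) (x : R) (l : List R) :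
    hpow (m + 1) (x :: l) = hpow (m + 1) l + x * hpow m (x :: l) := by
  rw [hpow]

theorem hz_cons {R : Type*} [CommSemiring R] (m : ℤ) (x : R) (l : List R) :
    hz m (x :: l) = hz m l + x * hz (m - 1) (x :: l) := by
  unfold hz
  rcases lt_trichotomy m 0 with h | rfl | h
  · rw [if_pos h, if_pos h, if_pos (by lia), mul_zero, add_zero]
  · simp [hpow]
  · obtain ⟨k, rfl⟩ : ∃ k : ℕ, m = (k + 1 : ℕ) := ⟨(m - 1).toNat, by lia⟩
    have h1 : ((k + 1 : ℕ) : ℤ) - 1 = (k : ℕ) := by push_cast; ring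
    rw [if_neg (by lia), if_neg (by lia), if_neg (by lia), h1, Int.toNat_natCast,
      Int.toNat_natCast, hpow_cons_succ]

theorem hz_of_neg {R : Type*} [CommSemiring R] {m : ℤ} (hm : m < 0) (l : List R) :
    hz m l = 0 :=
  if_pos hm

theorem hz_zero {R : Type*} [CommSemiring R] (l : List R) : hz 0 l = 1 := by
  simp [hz, hpow]

/-- A complete homogeneous symmetric polynomial at distinct points is a divided difference of a
monomial. -/
theorem hz_map_eq_sum {ι K : Type*} [DecidableEq ι] [Field K] (z : ι → K) (l : List ι)
    (hl : l.Nodup) (hne : l ≠ []) (hz_inj : Set.InjOn z (l.toFinset : Set ι)) (k : ℕ) :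
    hz ((k : ℤ) + 1 - l.length) (l.map z) =
      ∑ i ∈ l.toFinset, z i ^ k / ∏ j ∈ l.toFinset.erase i, (z i - z j) := by
  induction l generalizing k with
  | nil => exact absurd rfl hne
  | cons a l ih =>
    have hal : a ∉ l.toFinset := by simpa using (List.nodup_cons.1 hl).1
    rcases eq_or_ne l [] with rfl | hl0
    · induction k with
      | zero => simp [hz_zero]
      | succ k ihk =>
        have h : ((k + 1 : ℕ) : ℤ) + 1 - ([a] : List ι).length = k + 1 := by simp
        have h' : (k : ℤ) + 1 - ([a] : List ι).length = k := by simp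
        rw [h'] at ihk
        rw [h, List.map_cons, hz_cons, add_sub_cancel_right, ← List.map_cons, ihk]
        have : hz ((k : ℤ) + 1) (([] : List ι).map z) = 0 := by
          rw [hz, if_neg (by lia)]
          have : ((k : ℤ) + 1).toNat = k + 1 := by lia
          rw [this, List.map_nil, hpow]
        rw [this]
        simp [pow_succ, mul_comm]
    · have hcard : (a :: l).toFinset.card = l.length + 1 := by
        rw [List.toFinset_card_of_nodup hl, List.length_cons]
      have hpos : 0 < l.length := List.length_pos_iff.2 hl0
      induction k with
      | zero =>
        rw [hz_of_neg (by rw [List.length_cons]; push_cast; lia)]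
        have := Lagrange.coeff_eq_sum hz_inj (P := (1 : Polynomial K))
          (by rw [hcard, Polynomial.degree_one]; exact_mod_cast Nat.succ_pos _)
        rw [hcard, Polynomial.coeff_one, if_neg (by lia)] at this
        simpa using this
      | succ k ihk =>
        have hinj' : Set.InjOn z (l.toFinset : Set ι) :=
          hz_inj.mono (by simp [List.toFinset_cons])
        have e1 : ((k + 1 : ℕ) : ℤ) + 1 - (a :: l).length = (k : ℤ) + 1 - l.length := by
          rw [List.length_cons]; push_cast; ring
        have e2 : (k : ℤ) + 1 - l.length - 1 = (k : ℤ) + 1 - (a :: l).length := by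
          rw [List.length_cons]; push_cast; ring
        rw [e1, List.map_cons, hz_cons, e2, ← List.map_cons, ihk,
          ih (List.nodup_cons.1 hl).2 hl0 hinj' k, List.toFinset_cons, Finset.sum_insert hal,
          Finset.sum_insert hal, mul_add, Finset.mul_sum, add_left_comm, ← Finset.sum_add_distrib]
        congr 1
        · rw [pow_succ]; ring
        · refine Finset.sum_congr rfl fun i hi => ?_
          have hai : a ≠ i := fun h => hal (h ▸ hi)
          have hz_ne : z i - z a ≠ 0 := by
            refine sub_ne_zero.2 fun h => hai (hz_inj ?_ ?_ h.symm)
            · simp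
            · simpa using Or.inr (by simpa using hi)
          rw [Finset.erase_insert_of_ne hai, Finset.prod_insert (by simp [hal]), pow_succ]
          have : ∏ j ∈ l.toFinset.erase i, (z i - z j) ≠ 0 := by
            refine Finset.prod_ne_zero_iff.2 fun j hj => sub_ne_zero.2 fun h => ?_
            exact (Finset.mem_erase.1 hj).1 (hinj' (Finset.mem_erase.1 hj).2 hi h.symm)
          field_simp
          ring

/-- Expansion of a power of `z ^ 2 + w * z`. -/
theorem sq_add_mul_pow {R : Type*} [CommRing R] (z w : R) (j : ℕ) :
    (z ^ 2 + w * z) ^ j =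
      ∑ k ∈ Finset.Icc j (2 * j), (Nat.choose j (k - j) : R) * w ^ (2 * j - k) * z ^ k := by
  have h : z ^ 2 + w * z = z * (z + w) := by ring
  rw [h, mul_pow, add_pow, Finset.mul_sum, ← Finset.Ico_add_one_right_eq_Icc,
    Finset.sum_Ico_eq_sum_range, show 2 * j + 1 - j = j + 1 by lia]
  refine Finset.sum_congr rfl fun k hk => ?_
  have hk' : k ≤ j := by simpa [Nat.lt_succ_iff] using hk
  rw [show j + k - j = k by lia, show 2 * j - (j + k) = j - k by lia, pow_add]
  ring

open Polynomial in
/-- Power sums of two elements are monic polynomials in their sum, once their product is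
fixed. -/
theorem exists_monic_eval_pow_add_pow {K : Type*} [Field K] (q : K) (k : ℕ) :
    ∃ p : K[X], p.Monic ∧ p.natDegree = k + 1 ∧
      ∀ x y, x * y = q → p.eval (x + y) = x ^ (k + 1) + y ^ (k + 1) := by
  induction k using Nat.strong_induction_on with
  | _ k ih =>
    match k, ih with
    | 0, _ => exact ⟨X, monic_X, natDegree_X, by simp⟩
    | 1, _ =>
      refine ⟨X ^ 2 - C (2 * q), monic_X_pow_sub_C _ two_ne_zero, natDegree_X_pow_sub_C, ?_⟩
      rintro x y rfl
      simp only [eval_sub, eval_pow, eval_X, eval_C]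
      ring
    | k + 2, ih =>
      obtain ⟨p₀, hm₀, hd₀, he₀⟩ := ih k (by lia)
      obtain ⟨p₁, hm₁, hd₁, he₁⟩ := ih (k + 1) (by lia)
      have hd : (X * p₁).natDegree = k + 3 := by
        rw [monic_X.natDegree_mul hm₁, natDegree_X, hd₁]; ring
      have hlt : (C q * p₀).degree < (X * p₁).degree := by
        refine degree_lt_degree ((natDegree_C_mul_le _ _).trans_lt ?_)
        rw [hd, hd₀]; lia
      refine ⟨X * p₁ - C q * p₀, (monic_X.mul hm₁).sub_of_left hlt, ?_, ?_⟩
      · rw [natDegree_eq_of_degree_eq (degree_sub_eq_left_of_degree_lt hlt), hd]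
      · rintro x y rfl
        simp only [eval_sub, eval_mul, eval_X, eval_C, he₀ x y rfl, he₁ x y rfl]
        ring

open Polynomial in
/-- The quotients `(x ^ (k + 1) - y ^ (k + 1)) / (x - y)` are monic polynomials in `x + y`, once
`x * y` is fixed. -/
theorem exists_monic_eval_pow_sub_pow {K : Type*} [Field K] (q : K) (k : ℕ) :
    ∃ p : K[X], p.Monic ∧ p.natDegree = k ∧
      ∀ x y, x * y = q → p.eval (x + y) * (x - y) = x ^ (k + 1) - y ^ (k + 1) := by
  induction k using Nat.strong_induction_on with
  | _ k ih =>
    match k, ih with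
    | 0, _ => exact ⟨1, monic_one, natDegree_one, by simp⟩
    | 1, _ =>
      refine ⟨X, monic_X, natDegree_X, fun x y _ => ?_⟩
      rw [eval_X]
      ring
    | k + 2, ih =>
      obtain ⟨p₀, hm₀, hd₀, he₀⟩ := ih k (by lia)
      obtain ⟨p₁, hm₁, hd₁, he₁⟩ := ih (k + 1) (by lia)
      have hd : (X * p₁).natDegree = k + 2 := by
        rw [monic_X.natDegree_mul hm₁, natDegree_X, hd₁]; ring
      have hlt : (C q * p₀).degree < (X * p₁).degree := by
        refine degree_lt_degree ((natDegree_C_mul_le _ _).trans_lt ?_)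
        rw [hd, hd₀]; lia
      refine ⟨X * p₁ - C q * p₀, (monic_X.mul hm₁).sub_of_left hlt, ?_, ?_⟩
      · rw [natDegree_eq_of_degree_eq (degree_sub_eq_left_of_degree_lt hlt), hd]
      · rintro x y rfl
        simp only [eval_sub, eval_mul, eval_X, eval_C]
        linear_combination (x + y) * he₁ x y rfl - x * y * he₀ x y rfl

open Polynomial in
theorem det_eval_monic {K : Type*} [Field K] {n : ℕ} (s c : Fin n → K) (p : Fin n → K[X])
    (hd : ∀ i, (p i).natDegree = i) (hm : ∀ i, (p i).Monic) :
    (Matrix.of fun i l => (p i).eval (s l) * c l).det =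
      (∏ i, ∏ j ∈ Finset.Ioi i, (s j - s i)) * ∏ l, c l := by
  have h := Matrix.det_mul_row c (Matrix.of fun i l => (p i).eval (s l))
  rw [← Matrix.det_transpose (Matrix.of fun i l => (p i).eval (s l))] at h
  have h2 := Matrix.det_eval_matrixOfPolynomials_eq_det_vandermonde s p hd hm
  have h3 : (Matrix.of fun i l => (p i).eval (s l)).transpose =
      Matrix.of fun l i => (p i).eval (s l) := rfl
  rw [h3, ← h2, Matrix.det_vandermonde] at h
  rw [mul_comm, ← h]
  congr 1
  ext i l
  simp [mul_comm]

open Polynomial in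
theorem det_eval_monic_rev {K : Type*} [Field K] {n : ℕ} (s c : Fin n → K) (p : Fin n → K[X])
    (hd : ∀ i, (p i).natDegree = i) (hm : ∀ i, (p i).Monic) :
    (Matrix.of fun i l => (p i.rev).eval (s l) * c l).det =
      (∏ i, ∏ j ∈ Finset.Ioi i, (s i - s j)) * ∏ l, c l := by
  have h1 := Matrix.det_permute Fin.revPerm (Matrix.of fun i l => (p i).eval (s l) * c l)
  have h2 := Matrix.det_permute' Fin.revPerm (Matrix.vandermonde s)
  have h3 : (Matrix.vandermonde s).submatrix id Fin.revPerm = Matrix.projVandermonde 1 s := by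
    ext i j
    simp [Matrix.vandermonde_apply, Matrix.projVandermonde_apply]
  have h4 : (Matrix.of fun i l => (p i.rev).eval (s l) * c l) =
      (Matrix.of fun i l => (p i).eval (s l) * c l).submatrix Fin.revPerm id := by
    ext i j
    simp
  rw [h3, Matrix.det_projVandermonde, Matrix.det_vandermonde] at h2
  rw [h4, h1, det_eval_monic s c p hd hm, ← mul_assoc, ← h2]
  simp

section Pairs

variable {K : Type*} [Field K]

theorem prod_erase_inl {ι : Type*} [Fintype ι] [DecidableEq ι] (x y : ι → K) (q : K)
    (hxy : ∀ i, x i * y i = q) (l : ι) :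
    ∏ j ∈ Finset.univ.erase (Sum.inl l), (x l - Sum.elim x y j) =
      x l ^ (Fintype.card ι - 1) * ((x l - y l) *
        ∏ j ∈ Finset.univ.erase l, (x l + y l - (x j + y j))) := by
  have h : (Finset.univ.erase (Sum.inl l) : Finset (ι ⊕ ι)) =
      (Finset.univ.erase l).disjSum Finset.univ := by
    ext (j | j) <;> simp
  rw [h, Finset.prod_disjSum, ← Finset.mul_prod_erase Finset.univ _ (Finset.mem_univ l)]
  simp only [Sum.elim_inl, Sum.elim_inr]
  rw [mul_left_comm, mul_left_comm (x l ^ _), ← Finset.prod_mul_distrib,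
    ← Finset.card_univ, ← Finset.card_erase_of_mem (Finset.mem_univ l), ← Finset.prod_const,
    ← Finset.prod_mul_distrib]
  congr 1
  refine Finset.prod_congr rfl fun j _ => ?_
  linear_combination hxy j - hxy l

theorem prod_erase_inr {ι : Type*} [Fintype ι] [DecidableEq ι] (x y : ι → K) (q : K)
    (hxy : ∀ i, x i * y i = q) (l : ι) :
    ∏ j ∈ Finset.univ.erase (Sum.inr l), (y l - Sum.elim x y j) =
      y l ^ (Fintype.card ι - 1) * ((y l - x l) *
        ∏ j ∈ Finset.univ.erase l, (x l + y l - (x j + y j))) := by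
  have h : (Finset.univ.erase (Sum.inr l) : Finset (ι ⊕ ι)) =
      Finset.univ.disjSum (Finset.univ.erase l) := by
    ext (j | j) <;> simp
  rw [h, Finset.prod_disjSum, ← Finset.mul_prod_erase Finset.univ _ (Finset.mem_univ l)]
  simp only [Sum.elim_inl, Sum.elim_inr]
  rw [mul_left_comm, mul_assoc, ← Finset.prod_mul_distrib,
    ← Finset.card_univ, ← Finset.card_erase_of_mem (Finset.mem_univ l), ← Finset.prod_const,
    ← Finset.prod_mul_distrib]
  congr 1
  refine Finset.prod_congr rfl fun j _ => ?_
  linear_combination hxy j - hxy l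

/-- Grouping a divided difference over the `x i` and the `y i` into pairs `x i * y i = q`. -/
theorem sum_div_prod_erase {ι : Type*} [Fintype ι] [DecidableEq ι] (x y : ι → K) (q : K)
    (hxy : ∀ i, x i * y i = q) (hq : q ≠ 0) (g : ι ⊕ ι → K) (A B : ι → K)
    (hA : ∀ l, g (Sum.inl l) = x l ^ (Fintype.card ι - 1) * A l)
    (hB : ∀ l, g (Sum.inr l) = y l ^ (Fintype.card ι - 1) * B l) :
    ∑ i, g i / ∏ j ∈ Finset.univ.erase i, (Sum.elim x y i - Sum.elim x y j) =
      ∑ l, (A l - B l) / (x l - y l) /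
        ∏ j ∈ Finset.univ.erase l, (x l + y l - (x j + y j)) := by
  rw [Fintype.sum_sum_type, ← Finset.sum_add_distrib]
  refine Finset.sum_congr rfl fun l _ => ?_
  have hx : x l ≠ 0 := fun h => hq (by rw [← hxy l, h, zero_mul])
  have hy : y l ≠ 0 := fun h => hq (by rw [← hxy l, h, mul_zero])
  simp only [Sum.elim_inl, Sum.elim_inr]
  rw [prod_erase_inl x y q hxy, prod_erase_inr x y q hxy, hA, hB,
    mul_div_mul_left _ _ (pow_ne_zero _ hx), mul_div_mul_left _ _ (pow_ne_zero _ hy),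
    ← div_div, ← div_div, sub_div, sub_div, ← neg_sub (x l) (y l), div_neg, neg_div,
    ← sub_eq_add_neg]

variable {n : ℕ} (x y : Fin n → K) (q w : K)

theorem elim_injective (hxy : ∀ i, x i * y i = q) (hq : q ≠ 0) (hne : ∀ i, x i ≠ y i)
    (hs : Function.Injective fun i => x i + y i) : Function.Injective (Sum.elim x y) := by
  have hx : ∀ l, x l ≠ 0 := fun l h => hq (by rw [← hxy l, h, zero_mul])
  have hy : ∀ l, y l ≠ 0 := fun l h => hq (by rw [← hxy l, h, mul_zero])
  have key : ∀ i j, x i = y j → False := fun i j h => by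
    have h' : y i = x j := by
      apply mul_left_cancel₀ (hx i)
      rw [hxy i, h, mul_comm, hxy j]
    have hij : i = j := hs (by simp only [h, h', add_comm])
    exact hne j (hij ▸ h)
  rintro (i | i) (j | j) h <;> simp only [Sum.elim_inl, Sum.elim_inr] at h
  · have h' : y i = y j := by
      apply mul_left_cancel₀ (hx i)
      rw [hxy i, h, hxy j]
    exact congrArg _ (hs (by simp only [h, h']))
  · exact (key _ _ h).elim
  · exact (key _ _ h.symm).elim
  · have h' : x i = x j := by
      apply mul_right_cancel₀ (hy i)
      rw [hxy i, h, hxy j]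
    exact congrArg _ (hs (by simp only [h, h']))

/-- Binomial sums of complete homogeneous symmetric polynomials of degrees `k + b`, as divided
differences. -/
theorem sum_choose_mul_hz (hinj : Function.Injective (Sum.elim x y)) (hn : n ≠ 0) (j a : ℕ)
    (b : ℤ) (hab : (a : ℤ) = b + 2 * n - 1) :
    ∑ k ∈ Finset.Icc j (2 * j), (Nat.choose j (k - j) : K) * w ^ (2 * j - k) *
        hz ((k : ℤ) + b) ((List.finRange n).map x ++ (List.finRange n).map y) =
      ∑ i, (Sum.elim x y i ^ 2 + w * Sum.elim x y i) ^ j * Sum.elim x y i ^ a /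
        ∏ l ∈ Finset.univ.erase i, (Sum.elim x y i - Sum.elim x y l) := by
  set L : List (Fin n ⊕ Fin n) :=
    (List.finRange n).map Sum.inl ++ (List.finRange n).map Sum.inr with hL
  have hLz : (List.finRange n).map x ++ (List.finRange n).map y = L.map (Sum.elim x y) := by
    simp [hL, Function.comp_def]
  have hnd : L.Nodup := by
    refine List.Nodup.append ?_ ?_ ?_
    · exact (List.nodup_finRange n).map Sum.inl_injective
    · exact (List.nodup_finRange n).map Sum.inr_injective
    · intro i h1 h2
      simp only [List.mem_map] at h1 h2
      obtain ⟨_, _, rfl⟩ := h1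
      obtain ⟨_, _, h⟩ := h2
      exact Sum.inr_ne_inl h
  have hlen : L.length = 2 * n := by simp [hL]; ring
  have huniv : L.toFinset = Finset.univ := by
    ext (i | i) <;> simp [hL]
  have hLne : L ≠ [] := fun h => by
    rw [h, List.length_nil] at hlen
    lia
  have hk : ∀ k : ℕ, hz ((k : ℤ) + b) (L.map (Sum.elim x y)) =
      ∑ i, Sum.elim x y i ^ (k + a) /
        ∏ l ∈ Finset.univ.erase i, (Sum.elim x y i - Sum.elim x y l) := fun k => by
    have := hz_map_eq_sum (Sum.elim x y) L hnd hLne hinj.injOn (k + a)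
    rw [huniv] at this
    rw [← this, hlen]
    congr 1
    push_cast
    lia
  rw [hLz]
  simp_rw [hk, Finset.mul_sum]
  rw [Finset.sum_comm]
  refine Finset.sum_congr rfl fun i _ => ?_
  rw [sq_add_mul_pow, Finset.sum_mul, Finset.sum_div]
  refine Finset.sum_congr rfl fun k _ => ?_
  rw [pow_add]
  ring

section JacobiTrudi

variable {m : ℕ} (x y : Fin (m + 1) → K) (u v w : K)

theorem sum_choose_mul_hz_sub (hxy : ∀ i, x i * y i = u * v) (hq : u * v ≠ 0)
    (hne : ∀ i, x i ≠ y i) (hs : Function.Injective fun i => x i + y i) (i r : ℕ) (hi : i ≤ m) :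
    ∑ k ∈ Finset.Icc r (2 * r), (Nat.choose r (k - r) : K) * w ^ (2 * r - k) *
        (hz ((k : ℤ) - (i + 1)) ((List.finRange (m + 1)).map x ++ (List.finRange (m + 1)).map y) -
          u ^ (m + 1 - (i + 1)) * v ^ (m + 1 - (i + 1)) * hz ((k : ℤ) + (i + 1) - 2 * (m + 1 : ℕ))
            ((List.finRange (m + 1)).map x ++ (List.finRange (m + 1)).map y)) =
      ∑ l, (((x l ^ 2 + w * x l) ^ r + (y l ^ 2 + w * y l) ^ r) *
        (x l ^ (m - i) - y l ^ (m - i))) / (x l - y l) /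
          ∏ j ∈ Finset.univ.erase l, (x l + y l - (x j + y j)) := by
  have hinj := elim_injective x y _ hxy hq hne hs
  have h1 := sum_choose_mul_hz x y w hinj (Nat.succ_ne_zero m) r (m + (m - i))
    (-((i : ℤ) + 1)) (by push_cast [Nat.cast_sub hi]; ring)
  have h2 := sum_choose_mul_hz x y w hinj (Nat.succ_ne_zero m) r i
    ((i : ℤ) + 1 - 2 * (m + 1 : ℕ)) (by push_cast; ring)
  have h3 : ∀ k : ℕ, (k : ℤ) - (i + 1) = k + (-((i : ℤ) + 1)) := fun k => by ring
  have h4 : ∀ k : ℕ, (k : ℤ) + (i + 1) - 2 * (m + 1 : ℕ) =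
    k + ((i : ℤ) + 1 - 2 * (m + 1 : ℕ)) := fun k => by ring
  have h5 : m + 1 - (i + 1) = m - i := by lia
  simp_rw [h3, h4, h5, mul_sub, Finset.sum_sub_distrib, h1,
    mul_left_comm _ (u ^ (m - i) * v ^ (m - i)), ← Finset.mul_sum, h2, Finset.mul_sum,
    ← Finset.sum_sub_distrib, ← mul_div_assoc, ← sub_div]
  rw [sum_div_prod_erase x y _ hxy hq _
    (fun l => (x l ^ 2 + w * x l) ^ r * (x l ^ (m - i) - y l ^ (m - i)))
    (fun l => (y l ^ 2 + w * y l) ^ r * (y l ^ (m - i) - x l ^ (m - i)))]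
  · exact Finset.sum_congr rfl fun l _ => by ring
  · intro l
    have h5 : x l ^ m = x l ^ (m - i) * x l ^ i := by rw [← pow_add, Nat.sub_add_cancel hi]
    simp only [Sum.elim_inl, Fintype.card_fin, Nat.add_sub_cancel, pow_add, ← mul_pow u v, ← hxy l]
    rw [h5]
    ring
  · intro l
    have h5 : y l ^ m = y l ^ (m - i) * y l ^ i := by rw [← pow_add, Nat.sub_add_cancel hi]
    simp only [Sum.elim_inr, Fintype.card_fin, Nat.add_sub_cancel, pow_add, ← mul_pow u v, ← hxy l]
    rw [h5]
    ring

theorem sum_choose_mul_hz_add (hxy : ∀ i, x i * y i = u * v) (hq : u * v ≠ 0)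
    (hne : ∀ i, x i ≠ y i) (hs : Function.Injective fun i => x i + y i) (i r : ℕ) (hi : i ≤ m) :
    ∑ k ∈ Finset.Icc r (2 * r), (Nat.choose r (k - r) : K) * w ^ (2 * r - k) *
        (hz ((k : ℤ) + (i + 1) - (m + 1 : ℕ) - 1)
            ((List.finRange (m + 1)).map x ++ (List.finRange (m + 1)).map y) +
          u ^ i * v ^ i * hz ((k : ℤ) - (i + 1) - (m + 1 : ℕ) + 1)
            ((List.finRange (m + 1)).map x ++ (List.finRange (m + 1)).map y)) =
      ∑ l, (((x l ^ 2 + w * x l) ^ r - (y l ^ 2 + w * y l) ^ r) *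
        (x l ^ i + y l ^ i)) / (x l - y l) /
          ∏ j ∈ Finset.univ.erase l, (x l + y l - (x j + y j)) := by
  have hinj := elim_injective x y _ hxy hq hne hs
  have h1 := sum_choose_mul_hz x y w hinj (Nat.succ_ne_zero m) r (m + i)
    ((i : ℤ) + 1 - (m + 1 : ℕ) - 1) (by push_cast; ring)
  have h2 := sum_choose_mul_hz x y w hinj (Nat.succ_ne_zero m) r (m - i)
    (-((i : ℤ) + 1) - (m + 1 : ℕ) + 1) (by push_cast [Nat.cast_sub hi]; ring)
  have h3 : ∀ k : ℕ, (k : ℤ) + (i + 1) - (m + 1 : ℕ) - 1 =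
    k + ((i : ℤ) + 1 - (m + 1 : ℕ) - 1) := fun k => by ring
  have h4 : ∀ k : ℕ, (k : ℤ) - (i + 1) - (m + 1 : ℕ) + 1 =
    k + (-((i : ℤ) + 1) - (m + 1 : ℕ) + 1) := fun k => by ring
  simp_rw [h3, h4, mul_add, Finset.sum_add_distrib, h1, mul_left_comm _ (u ^ i * v ^ i),
    ← Finset.mul_sum, h2, Finset.mul_sum, ← Finset.sum_add_distrib, ← mul_div_assoc, ← add_div]
  rw [sum_div_prod_erase x y _ hxy hq _
    (fun l => (x l ^ 2 + w * x l) ^ r * (x l ^ i + y l ^ i))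
    (fun l => (y l ^ 2 + w * y l) ^ r * (x l ^ i + y l ^ i))]
  · exact Finset.sum_congr rfl fun l _ => by ring
  · intro l
    have h5 : x l ^ m = x l ^ (m - i) * x l ^ i := by rw [← pow_add, Nat.sub_add_cancel hi]
    simp only [Sum.elim_inl, Fintype.card_fin, Nat.add_sub_cancel, pow_add, ← mul_pow u v, ← hxy l]
    rw [h5]
    ring
  · intro l
    have h5 : y l ^ m = y l ^ (m - i) * y l ^ i := by rw [← pow_add, Nat.sub_add_cancel hi]
    simp only [Sum.elim_inr, Fintype.card_fin, Nat.add_sub_cancel, pow_add, ← mul_pow u v, ← hxy l]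
    rw [h5]
    ring

open Polynomial in
theorem two_mul_det_sum_sub (q : K) (F : Fin (m + 1) → ℕ → K) (hF : ∀ l, F l 0 = 2)
    (hxy : ∀ i, x i * y i = q) (hne : ∀ i, x i ≠ y i)
    (hs : Function.Injective fun i => x i + y i) :
    2 * (Matrix.of fun i j : Fin m => ∑ l, (F l (j + 1) *
        (x l ^ (m - i) - y l ^ (m - i))) / (x l - y l) /
          ∏ k ∈ Finset.univ.erase l, (x l + y l - (x k + y k))).det =
      (∏ i, ∏ j ∈ Finset.Ioi i, (x i + y i - (x j + y j))) *
        (∏ l, (∏ k ∈ Finset.univ.erase l, (x l + y l - (x k + y k)))⁻¹) *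
        (Matrix.of fun l j : Fin (m + 1) => F l j).det := by
  choose p hm hd he using exists_monic_eval_pow_sub_pow q
  rw [← det_eval_monic_rev _ _ (fun i => p i) (fun i => hd i) (fun i => hm i), ← Matrix.det_mul,
    Matrix.det_succ_column_zero, Fin.sum_univ_succ]
  have h0 : ∀ i : Fin (m + 1),
      ((Matrix.of fun i l : Fin (m + 1) => (p i.rev).eval (x l + y l) *
        (∏ k ∈ Finset.univ.erase l, (x l + y l - (x k + y k)))⁻¹) *
        (Matrix.of fun l j : Fin (m + 1) => F l j)) i 0 = if i = 0 then 2 else 0 := fun i => by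
    have h := Lagrange.coeff_eq_sum (s := Finset.univ) (v := fun i => x i + y i) hs.injOn
      (P := p i.rev) (by
        rw [Polynomial.degree_eq_natDegree (hm _).ne_zero, hd]
        rw [Finset.card_univ, Fintype.card_fin]
        exact_mod_cast i.rev.is_lt)
    have h' : (p i.rev).coeff m = if i = 0 then 1 else 0 := by
      split_ifs with hi
      · subst hi
        have := (hm m).coeff_natDegree
        rw [hd] at this
        simpa using this
      · refine coeff_eq_zero_of_natDegree_lt ?_
        rw [hd, Fin.val_rev]
        have : (i : ℕ) ≠ 0 := fun h => hi (Fin.ext h)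
        lia
    rw [Finset.card_univ, Fintype.card_fin, Nat.add_sub_cancel, h'] at h
    simp only [Matrix.mul_apply, Matrix.of_apply, Fin.val_zero, hF]
    rw [← Finset.sum_mul]
    simp_rw [← div_eq_mul_inv]
    rw [← h]
    split_ifs <;> simp
  rw [Finset.sum_eq_zero fun i _ => by rw [h0, if_neg (Fin.succ_ne_zero i)]; ring, h0]
  simp only [if_true, Fin.val_zero, pow_zero, one_mul, add_zero]
  congr 2
  ext i j
  simp only [Matrix.of_apply, Matrix.submatrix_apply, Matrix.mul_apply, Fin.succAbove_zero,
    Fin.val_succ]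
  refine Finset.sum_congr rfl fun l _ => ?_
  have h1 := he (m - (i + 1)) (x l) (y l) (hxy l)
  rw [show m - ((i : ℕ) + 1) + 1 = m - i by lia] at h1
  rw [← h1, Fin.val_rev, Fin.val_succ, show m + 1 - ((i : ℕ) + 1 + 1) = m - (i + 1) by lia,
    ← mul_assoc, mul_div_cancel_right₀ _ (sub_ne_zero.2 (hne l)), div_eq_mul_inv]
  ring

open Polynomial in
theorem det_sum_add (q : K) (F : Fin (m + 1) → ℕ → K) (hxy : ∀ i, x i * y i = q) :
    (Matrix.of fun i j : Fin (m + 1) => ∑ l, (F l (j + 1) *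
        (x l ^ (i : ℕ) + y l ^ (i : ℕ))) / (x l - y l) /
          ∏ k ∈ Finset.univ.erase l, (x l + y l - (x k + y k))).det =
      2 * ((∏ i, ∏ j ∈ Finset.Ioi i, (x j + y j - (x i + y i))) *
        (∏ l, (x l - y l)⁻¹ * (∏ k ∈ Finset.univ.erase l, (x l + y l - (x k + y k)))⁻¹) *
        (Matrix.of fun l j : Fin (m + 1) => F l (j + 1)).det) := by
  choose p hm hd he using exists_monic_eval_pow_add_pow q
  rw [← det_eval_monic _ _ (fun i : Fin (m + 1) => Fin.cases 1 (fun k : Fin m => p k) i)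
    (fun i => by refine Fin.cases ?_ (fun k => ?_) i <;> simp [hd])
    (fun i => by refine Fin.cases ?_ (fun k => ?_) i <;> simp [hm])]
  have h2 : (2 : K) = ∏ i : Fin (m + 1), Fin.cases 2 (fun _ => 1) i := by
    simp [Fin.prod_univ_succ]
  rw [← Matrix.det_mul, h2, ← Matrix.det_mul_column]
  congr 1
  ext i j
  simp only [Matrix.of_apply, Matrix.mul_apply, Finset.mul_sum]
  refine Finset.sum_congr rfl fun l _ => ?_
  refine Fin.cases ?_ (fun k => ?_) i
  · simp only [Fin.cases_zero, Fin.val_zero, pow_zero, eval_one, div_eq_mul_inv]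
    ring
  · simp only [Fin.cases_succ, Fin.val_succ, he _ _ _ (hxy l), div_eq_mul_inv]
    ring

end JacobiTrudi

/-- Pairing the off-diagonal factors. -/
theorem prod_inv_prod_erase {n : ℕ} (s : Fin n → K) :
    ∏ l, (∏ k ∈ Finset.univ.erase l, (s l - s k))⁻¹ =
      (∏ i, ∏ j ∈ Finset.Ioi i, (s i - s j))⁻¹ * (∏ i, ∏ j ∈ Finset.Ioi i, (s j - s i))⁻¹ := by
  have h := Finset.prod_prod_Ioi_mul_eq_prod_prod_off_diag fun i j => s j - s i
  rw [Finset.prod_inv_distrib, ← mul_inv]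
  simp_rw [← Finset.compl_singleton, ← h, Finset.prod_mul_distrib]

theorem prod_prod_sub {n : ℕ} (x y : Fin n → K) (q : K) (hxy : ∀ i, x i * y i = q) :
    (∏ i, ∏ j ∈ Finset.Ioi i, ((x j - x i) * (y j - y i))) * ∏ i, ∏ j, (y j - x i) =
      (-1) ^ n * (∏ i : Fin n, ∏ _j ∈ Finset.Ioi i, q) *
        ((∏ i, ∏ j ∈ Finset.Ioi i, (x i + y i - (x j + y j))) *
          (∏ i, ∏ j ∈ Finset.Ioi i, (x j + y j - (x i + y i))) * ∏ i, (x i - y i)) := by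
  have h := Finset.prod_prod_Ioi_mul_eq_prod_prod_off_diag fun j i => y j - x i
  have h1 : ∏ i, ∏ j, (y j - x i) =
      (-1) ^ n * (∏ i, (x i - y i)) * ∏ i, ∏ j ∈ Finset.Ioi i, ((y j - x i) * (y i - x j)) := by
    have hc : ((-1) ^ n : K) = ∏ _i : Fin n, (-1) := by simp
    rw [h, hc, ← Finset.prod_mul_distrib, ← Finset.prod_mul_distrib]
    refine Finset.prod_congr rfl fun i _ => ?_
    rw [Fintype.prod_eq_mul_prod_compl i, neg_one_mul, neg_sub]
  have h2 : (∏ i, ∏ j ∈ Finset.Ioi i, ((x j - x i) * (y j - y i))) *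
      (∏ i, ∏ j ∈ Finset.Ioi i, ((y j - x i) * (y i - x j))) =
      (∏ i : Fin n, ∏ _j ∈ Finset.Ioi i, q) *
        ((∏ i, ∏ j ∈ Finset.Ioi i, (x i + y i - (x j + y j))) *
          ∏ i, ∏ j ∈ Finset.Ioi i, (x j + y j - (x i + y i))) := by
    simp only [← Finset.prod_mul_distrib]
    refine Finset.prod_congr rfl fun i _ => Finset.prod_congr rfl fun j _ => ?_
    have e1 : (x j - x i) * (x j - y i) = x j * (x j + y j - (x i + y i)) := by
      linear_combination hxy i - hxy j
    have e2 : (y j - y i) * (y j - x i) = y j * (x j + y j - (x i + y i)) := by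
      linear_combination hxy i - hxy j
    linear_combination (-((y j - y i) * (y j - x i))) * e1 -
      x j * (x j + y j - (x i + y i)) * e2 - (x j + y j - (x i + y i)) ^ 2 * hxy j
  rw [h1]
  linear_combination (-1) ^ n * (∏ i, (x i - y i)) * h2

theorem prod_prod_Ioi_const {n : ℕ} (c : K) :
    ∏ i : Fin n, ∏ _j ∈ Finset.Ioi i, c = c ^ n.choose 2 := by
  simp_rw [Finset.prod_const, Fin.card_Ioi, Finset.prod_pow_eq_pow_sum]
  congr 1
  rw [Fin.sum_univ_eq_sum_range (fun i => n - 1 - i) n, Finset.sum_range_reflect (fun i => i) n,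
    Finset.sum_range_id, Nat.choose_two_right]

end Pairs
theorem prod_filter_lt {K : Type*} [CommMonoid K] {n : ℕ} (f : Fin n → Fin n → K) :
    ∏ p ∈ Finset.univ.filter (fun p : Fin n × Fin n => p.1 < p.2), f p.1 p.2 =
      ∏ i, ∏ j ∈ Finset.Ioi i, f i j := by
  rw [Finset.prod_filter, Fintype.prod_prod_type]
  refine Finset.prod_congr rfl fun i _ => ?_
  rw [← Finset.prod_filter, Finset.filter_lt_eq_Ioi]

theorem algebraMap_Fld_injective (n : ℕ) :
    Function.Injective (algebraMap (MvPolynomial (Fin n ⊕ Fin 3) ℚ) (Fld n)) :=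
  IsFractionRing.injective _ _

theorem uu_ne_zero (n : ℕ) : uu n ≠ 0 :=
  (map_ne_zero_iff _ (algebraMap_Fld_injective n)).2 (MvPolynomial.X_ne_zero _)

theorem vv_ne_zero (n : ℕ) : vv n ≠ 0 :=
  (map_ne_zero_iff _ (algebraMap_Fld_injective n)).2 (MvPolynomial.X_ne_zero _)

theorem XP_ne_zero {n : ℕ} (i : Fin n) : XP i ≠ 0 :=
  (map_ne_zero_iff _ (algebraMap_Fld_injective n)).2 (MvPolynomial.X_ne_zero _)

theorem XP_injective (n : ℕ) : Function.Injective (XP (n := n)) := fun _ _ h =>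
  Sum.inl_injective (MvPolynomial.X_injective (algebraMap_Fld_injective n h))

theorem uu_mul_XP_mul_XP_ne {n : ℕ} (i j : Fin n) : uu n * XP i * XP j ≠ vv n := by
  unfold uu XP vv
  rw [← map_mul, ← map_mul]
  intro h
  have h' := congrArg (MvPolynomial.eval (Sum.elim (fun _ => 1) ![1, 0, 0]))
    (algebraMap_Fld_injective n h)
  simp at h'

theorem uu_mul_XP_ne {n : ℕ} (i : Fin n) : uu n * XP i ≠ vv n * (XP i)⁻¹ := fun h =>
  uu_mul_XP_mul_XP_ne i i (by rw [h, inv_mul_cancel_right₀ (XP_ne_zero i)])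

theorem sum_injective (n : ℕ) :
    Function.Injective fun i : Fin n => uu n * XP i + vv n * (XP i)⁻¹ := by
  intro i j h
  have hi := XP_ne_zero i
  have hj := XP_ne_zero j
  simp only at h
  field_simp at h
  have h' : (XP i - XP j) * (uu n * XP i * XP j - vv n) = 0 := by linear_combination h
  rcases mul_eq_zero.1 h' with h' | h'
  · exact XP_injective n (sub_eq_zero.1 h')
  · exact (uu_mul_XP_mul_XP_ne i j (sub_eq_zero.1 h')).elim

theorem prod_denominator (n : ℕ) :
    ((∏ p ∈ Finset.univ.filter (fun p : Fin n × Fin n => p.1 < p.2),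
          ((XP p.2 - XP p.1) *
            ((uu n)⁻¹ * vv n * (XP p.2)⁻¹ - (uu n)⁻¹ * vv n * (XP p.1)⁻¹))) *
        ∏ i : Fin n, ∏ j : Fin n, ((uu n)⁻¹ * vv n * (XP j)⁻¹ - XP i)) =
      ((uu n)⁻¹ ^ 2) ^ n.choose 2 * (uu n)⁻¹ ^ n ^ 2 *
        ((∏ i, ∏ j ∈ Finset.Ioi i, ((uu n * XP j - uu n * XP i) *
          (vv n * (XP j)⁻¹ - vv n * (XP i)⁻¹))) *
            ∏ i : Fin n, ∏ j, (vv n * (XP j)⁻¹ - uu n * XP i)) := by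
  have hu := uu_ne_zero n
  have hc : (uu n)⁻¹ ^ n ^ 2 = ∏ _i : Fin n, ∏ _j : Fin n, (uu n)⁻¹ := by
    simp [pow_mul, sq]
  rw [prod_filter_lt fun i j : Fin n => (XP j - XP i) *
    ((uu n)⁻¹ * vv n * (XP j)⁻¹ - (uu n)⁻¹ * vv n * (XP i)⁻¹),
    ← prod_prod_Ioi_const (n := n) ((uu n)⁻¹ ^ 2),
    mul_mul_mul_comm, hc]
  congr 1
  · simp only [← Finset.prod_mul_distrib]
    refine Finset.prod_congr rfl fun i _ => Finset.prod_congr rfl fun j _ => ?_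
    linear_combination (uu n)⁻¹ * (XP i - XP j) * vv n * ((XP j)⁻¹ - (XP i)⁻¹) *
      inv_mul_cancel₀ hu
  · simp only [← Finset.prod_mul_distrib]
    refine Finset.prod_congr rfl fun i _ => Finset.prod_congr rfl fun j _ => ?_
    linear_combination XP i * inv_mul_cancel₀ hu

/-- **Lemma 5.1 (2).** For `n ≥ 1`, in `ℚ(u,v,w,X_1,…,X_n)`, with all `h`'s evaluated at
`(u X_1, …, u X_n, v X_1^{−1}, …, v X_n^{−1})`:
the quotient of the product of the two bialternant determinants (the `+`-determinant with
exponent `j − 1`, the `−`-determinant with exponent `j`) by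
`∏_{1≤i<j≤n}(X_j − X_i)(u^{−1}vX_j^{−1} − u^{−1}vX_i^{−1}) · ∏_{i,j=1}^n (u^{−1}vX_j^{−1} − X_i)`
equals `(−1)^n u^{n² + C(n,2)} v^{−C(n,2)}` times the product of the two Jacobi–Trudi type
determinants, the first of size `n − 1` (equal to `1` when `n = 1`). -/
theorem det_product_eq_jacobiTrudi_product' (n : ℕ) (hn : 1 ≤ n) :
    ((Matrix.of fun i j : Fin n =>
          ((uu n) ^ 2 * (XP i) ^ 2 + uu n * wP n * XP i) ^ (j : ℕ) +
            ((vv n) ^ 2 * ((XP i)⁻¹) ^ 2 + vv n * wP n * (XP i)⁻¹) ^ (j : ℕ)).det *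
        (Matrix.of fun i j : Fin n =>
          ((uu n) ^ 2 * (XP i) ^ 2 + uu n * wP n * XP i) ^ ((j : ℕ) + 1) -
            ((vv n) ^ 2 * ((XP i)⁻¹) ^ 2 + vv n * wP n * (XP i)⁻¹) ^ ((j : ℕ) + 1)).det) /
      ((∏ p ∈ Finset.univ.filter (fun p : Fin n × Fin n => p.1 < p.2),
          ((XP p.2 - XP p.1) *
            ((uu n)⁻¹ * vv n * (XP p.2)⁻¹ - (uu n)⁻¹ * vv n * (XP p.1)⁻¹))) *
        ∏ i : Fin n, ∏ j : Fin n, ((uu n)⁻¹ * vv n * (XP j)⁻¹ - XP i)) =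
      ((-1 : Fld n) ^ n * uu n ^ (n ^ 2 + n.choose 2) * vv n ^ (-(n.choose 2 : ℤ))) *
        (Matrix.of fun i j : Fin (n - 1) =>
          ∑ k ∈ Finset.Icc ((j : ℕ) + 1) (2 * ((j : ℕ) + 1)),
            (Nat.choose ((j : ℕ) + 1) (k - ((j : ℕ) + 1)) : Fld n) *
              wP n ^ (2 * ((j : ℕ) + 1) - k) *
              (Hn n ((k : ℤ) - ((i : ℕ) + 1)) -
                uu n ^ (n - ((i : ℕ) + 1)) * vv n ^ (n - ((i : ℕ) + 1)) *
                  Hn n ((k : ℤ) + ((i : ℕ) + 1) - 2 * (n : ℤ)))).det *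
        (Matrix.of fun i j : Fin n =>
          ∑ k ∈ Finset.Icc ((j : ℕ) + 1) (2 * ((j : ℕ) + 1)),
            (Nat.choose ((j : ℕ) + 1) (k - ((j : ℕ) + 1)) : Fld n) *
              wP n ^ (2 * ((j : ℕ) + 1) - k) *
              (Hn n ((k : ℤ) + ((i : ℕ) + 1) - (n : ℤ) - 1) +
                uu n ^ (i : ℕ) * vv n ^ (i : ℕ) *
                  Hn n ((k : ℤ) - ((i : ℕ) + 1) - (n : ℤ) + 1))).det := by
  obtain ⟨m, rfl⟩ : ∃ m, n = m + 1 := ⟨n - 1, by lia⟩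
  have hu := uu_ne_zero (m + 1)
  have hv := vv_ne_zero (m + 1)
  set u := uu (m + 1)
  set v := vv (m + 1)
  set w := wP (m + 1)
  set x : Fin (m + 1) → Fld (m + 1) := fun i => u * XP i with hx
  set y : Fin (m + 1) → Fld (m + 1) := fun i => v * (XP i)⁻¹ with hy
  have hxy : ∀ i, x i * y i = u * v := fun i => by
    simp only [hx, hy]
    rw [mul_mul_mul_comm, mul_inv_cancel₀ (XP_ne_zero i), mul_one]
  have hq : u * v ≠ 0 := mul_ne_zero hu hv
  have hne : ∀ i, x i ≠ y i := uu_mul_XP_ne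
  have hs : Function.Injective fun i => x i + y i := sum_injective (m + 1)
  have hP : (Matrix.of fun i j : Fin (m + 1) =>
      (u ^ 2 * XP i ^ 2 + u * w * XP i) ^ (j : ℕ) +
        (v ^ 2 * (XP i)⁻¹ ^ 2 + v * w * (XP i)⁻¹) ^ (j : ℕ)) =
      Matrix.of fun i j : Fin (m + 1) =>
        (x i ^ 2 + w * x i) ^ (j : ℕ) + (y i ^ 2 + w * y i) ^ (j : ℕ) := by
    ext i j
    simp only [Matrix.of_apply, hx, hy]
    congr 2 <;> ring
  have hQ : (Matrix.of fun i j : Fin (m + 1) =>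
      (u ^ 2 * XP i ^ 2 + u * w * XP i) ^ ((j : ℕ) + 1) -
        (v ^ 2 * (XP i)⁻¹ ^ 2 + v * w * (XP i)⁻¹) ^ ((j : ℕ) + 1)) =
      Matrix.of fun i j : Fin (m + 1) =>
        (x i ^ 2 + w * x i) ^ ((j : ℕ) + 1) - (y i ^ 2 + w * y i) ^ ((j : ℕ) + 1) := by
    ext i j
    simp only [Matrix.of_apply, hx, hy]
    congr 2 <;> ring
  have hM₁ := two_mul_det_sum_sub x y (u * v)
    (fun l r => (x l ^ 2 + w * x l) ^ r + (y l ^ 2 + w * y l) ^ r)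
    (fun l => by norm_num) hxy hne hs
  have hM₂ := det_sum_add x y (u * v)
    (fun l r => (x l ^ 2 + w * x l) ^ r - (y l ^ 2 + w * y l) ^ r) hxy
  simp_rw [fun i j : Fin m => (sum_choose_mul_hz_sub x y u v w hxy hq hne hs i (j + 1)
    i.is_lt.le).symm] at hM₁
  simp_rw [fun i j : Fin (m + 1) => (sum_choose_mul_hz_add x y u v w hxy hq hne hs i (j + 1)
    (Nat.lt_succ_iff.1 i.is_lt)).symm] at hM₂
  rw [Finset.prod_mul_distrib, prod_inv_prod_erase fun i => x i + y i] at hM₂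
  rw [prod_inv_prod_erase fun i => x i + y i] at hM₁
  have hden := prod_denominator (m + 1)
  rw [prod_prod_sub x y (u * v) hxy, prod_prod_Ioi_const] at hden
  rw [hP, hQ, hden]
  set E := ∏ i, ∏ j ∈ Finset.Ioi i, (x i + y i - (x j + y j))
  set E' := ∏ i, ∏ j ∈ Finset.Ioi i, (x j + y j - (x i + y i))
  have hE0 : E ≠ 0 := Finset.prod_ne_zero_iff.2 fun i _ => Finset.prod_ne_zero_iff.2 fun j hj =>
    sub_ne_zero.2 fun h => (Finset.mem_Ioi.1 hj).ne (hs h)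
  have hE0' : E' ≠ 0 := Finset.prod_ne_zero_iff.2 fun i _ => Finset.prod_ne_zero_iff.2 fun j hj =>
    sub_ne_zero.2 fun h => (Finset.mem_Ioi.1 hj).ne' (hs h)
  have hD0 : ∏ i, (x i - y i) ≠ 0 := Finset.prod_ne_zero_iff.2 fun i _ => sub_ne_zero.2 (hne i)
  rw [Finset.prod_inv_distrib] at hM₂
  have key : ∀ d₁ d₂ M₁ M₂ : Fld (m + 1), 2 * M₁ = E * (E⁻¹ * E'⁻¹) * d₁ →
      M₂ = 2 * (E' * ((∏ l, (x l - y l))⁻¹ * (E⁻¹ * E'⁻¹)) * d₂) →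
      d₁ * d₂ / ((u⁻¹ ^ 2) ^ (m + 1).choose 2 * u⁻¹ ^ (m + 1) ^ 2 * ((-1) ^ (m + 1) *
        (u * v) ^ (m + 1).choose 2 * (E * E' * ∏ i, (x i - y i)))) =
      (-1 : Fld (m + 1)) ^ (m + 1) * u ^ ((m + 1) ^ 2 + (m + 1).choose 2) *
        v ^ (-((m + 1).choose 2 : ℤ)) * M₁ * M₂ := by
    intro d₁ d₂ M₁ M₂ h₁ h₂
    have h₃ : M₁ * M₂ = d₁ * d₂ / (E * E' * ∏ l, (x l - y l)) := by
      rw [h₂, ← mul_assoc, mul_comm M₁, h₁]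
      field_simp
    have hneg : ((-1 : Fld (m + 1)) ^ (m + 1)) ^ 2 = 1 := by
      rw [← pow_mul, mul_comm, pow_mul, neg_one_sq, one_pow]
    have hneg0 : ((-1 : Fld (m + 1)) ^ (m + 1)) ≠ 0 := pow_ne_zero _ (by norm_num)
    rw [mul_assoc _ M₁, h₃, zpow_neg, zpow_natCast]
    generalize (-1 : Fld (m + 1)) ^ (m + 1) = e at *
    generalize (m + 1).choose 2 = c
    generalize (m + 1) ^ 2 = a
    generalize ∏ l, (x l - y l) = D at *
    clear_value E E' u v
    rw [mul_pow, pow_add, inv_pow, inv_pow, inv_pow, ← pow_mul, mul_comm 2 c, pow_mul]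
    field_simp
    linear_combination (-d₁ * d₂) * hneg
  exact key _ _ _ _ hM₁ hM₂

end
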